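/- Let α > 0 and let G = (G_t)_{t ≥ 0} be a centered Gaussian process that is continuous in probability, with covariance function c(s,t) = E[G_s G_t]. Then G is an α-IDT process if and only if c(as, at) = a^α c(s,t) for all a > 0 and all 0 ≤ s ≤ t. -/

import Mathlib

open MeasureTheory ProbabilityTheory

/-- Two processes (indexed by nonnegative real times) have the same finite-dimensional
distributions: for every finite family of nonnegative times, the laws of the corresponding
finite-dimensional marginals coincide. -/
def HasSameFDD {Ω Ω' : Type*} [MeasurableSpace Ω] [MeasurableSpace Ω']
    (P : Measure Ω) (P' : Measure Ω') (X : ℝ → Ω → ℝ) (Y : ℝ → Ω' → ℝ) : Prop :=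
  ∀ (m : ℕ) (t : Fin m → ℝ), (∀ i, 0 ≤ t i) →
    Measure.map (fun ω i => X (t i) ω) P = Measure.map (fun ω i => Y (t i) ω) P'

/-- A process `X` is `α`-IDT if for every positive integer `n`, the time-rescaled process
`(X_{n^{1/α} t})_{t ≥ 0}` has the same finite-dimensional distributions as the sum of `n`
independent copies of `X` (realized canonically on the `n`-fold product space). -/
def IsAlphaIDT {Ω : Type*} [MeasurableSpace Ω] (P : Measure Ω) (α : ℝ)
    (X : ℝ → Ω → ℝ) : Prop :=
  ∀ n : ℕ, 0 < n →
    HasSameFDD P (Measure.pi fun _ : Fin n => P)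
      (fun t ω => X ((n : ℝ) ^ (1 / α) * t) ω)
      (fun t ω => ∑ j, X t (ω j))
/-- A process is stochastically continuous (continuous in probability) on `[0,∞)`. -/
def StochasticallyContinuous {Ω : Type*} [MeasurableSpace Ω] (P : Measure Ω)
    (X : ℝ → Ω → ℝ) : Prop :=
  ∀ s : ℝ, 0 ≤ s → TendstoInMeasure P X (nhdsWithin s (Set.Ici 0)) (X s)

/-- A process `G` is a centered Gaussian process if every finite linear combination of its
values at nonnegative times is a centered (one-dimensional) Gaussian random variable; by the
Cramér–Wold device this says exactly that all finite-dimensional marginals of `G` are centered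
Gaussian vectors. -/
def IsCenteredGaussianProcess {Ω : Type*} [MeasurableSpace Ω] (P : Measure Ω)
    (G : ℝ → Ω → ℝ) : Prop :=
  ∀ (m : ℕ) (t θ : Fin m → ℝ), (∀ i, 0 ≤ t i) →
    ∃ v : NNReal, Measure.map (fun ω => ∑ i, θ i * G (t i) ω) P = gaussianReal 0 v

open Filter Topology

section GaussianLaw

variable {Ω : Type*} [MeasurableSpace Ω] {P : Measure Ω}

/-- A random variable with a centered Gaussian law is square integrable. -/
lemma memLp_two_of_map_eq_gaussianReal {Z : Ω → ℝ} (hZ : Measurable Z) {v : NNReal}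
    (h : Measure.map Z P = gaussianReal 0 v) : MemLp Z 2 P := by
  have h2 : MemLp id 2 (Measure.map Z P) := h ▸ memLp_id_gaussianReal' 2 (by simp)
  exact (memLp_map_measure_iff aestronglyMeasurable_id hZ.aemeasurable).1 h2

/-- The variance of a centered Gaussian law is the second moment. -/
lemma integral_sq_of_map_eq_gaussianReal {Z : Ω → ℝ} (hZ : Measurable Z) {v : NNReal}
    (h : Measure.map Z P = gaussianReal 0 v) : ∫ ω, Z ω ^ 2 ∂P = v := by
  have h1 : ∫ x, x ^ 2 ∂(Measure.map Z P) = ∫ ω, Z ω ^ 2 ∂P :=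
    integral_map hZ.aemeasurable (by fun_prop)
  have h2 := variance_fun_id_gaussianReal (μ := 0) (v := v)
  rw [variance_eq_integral measurable_id'.aemeasurable, integral_id_gaussianReal] at h2
  rw [← h1, h, ← h2]
  simp

/-- The sum of `n` independent copies of a centered Gaussian variable of variance `v` is centered
Gaussian of variance `n * v`. -/
lemma map_sum_pi_eq_gaussianReal [IsProbabilityMeasure P] {Z : Ω → ℝ} (hZ : Measurable Z)
    {v : NNReal} (h : Measure.map Z P = gaussianReal 0 v) (n : ℕ) :
    Measure.map (fun ω : Fin n → Ω => ∑ j, Z (ω j)) (Measure.pi fun _ : Fin n => P)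
      = gaussianReal 0 (n * v) := by
  have hpi : Measure.map (fun (ω : Fin n → Ω) j => Z (ω j)) (Measure.pi fun _ : Fin n => P)
      = Measure.pi fun _ : Fin n => gaussianReal 0 v := by
    have : IsProbabilityMeasure (Measure.map Z P) := h ▸ inferInstance
    rw [← h]
    exact (Measure.pi_map_pi (μ := fun _ : Fin n => P) (f := fun _ => Z)
      fun _ => hZ.aemeasurable)
  have hcomp : Measure.map (fun ω : Fin n → Ω => ∑ j, Z (ω j)) (Measure.pi fun _ : Fin n => P)
      = Measure.map (fun p : Fin n → ℝ => ∑ j, p j) (Measure.pi fun _ => gaussianReal 0 v) := by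
    rw [← hpi, Measure.map_map (by fun_prop) (by fun_prop)]
    rfl
  rw [hcomp]
  have : IsProbabilityMeasure (Measure.map (fun p : Fin n → ℝ => ∑ j, p j)
      (Measure.pi fun _ => gaussianReal 0 v)) :=
    Measure.isProbabilityMeasure_map (by fun_prop)
  refine Measure.ext_of_charFun ?_
  rw [charFun_map_sum_pi_eq_prod]
  ext u
  simp only [Finset.prod_apply, charFun_gaussianReal, Finset.prod_const, Finset.card_univ,
    Fintype.card_fin, ← Complex.exp_nat_mul]
  congr 1
  push_cast
  ring

/-- If `X r` is centered Gaussian for every `r` and `X` is sequentially continuous almost surely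
along subsequences, then the second moment is continuous. -/
lemma continuous_integral_sq_of_gaussian [IsProbabilityMeasure P] {X : ℝ → Ω → ℝ}
    (hX : ∀ r, Measurable (X r)) (hG : ∀ r, ∃ v, Measure.map (X r) P = gaussianReal 0 v)
    (hsub : ∀ (r : ℝ) (u : ℕ → ℝ), Tendsto u atTop (𝓝 r) → ∃ ns : ℕ → ℕ,
      ∀ᵐ ω ∂P, Tendsto (fun k => X (u (ns k)) ω) atTop (𝓝 (X r ω))) :
    Continuous fun r => ∫ ω, X r ω ^ 2 ∂P := by
  have hchar : ∀ r, ∫ ω, Complex.exp (X r ω * Complex.I) ∂P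
      = (Real.exp (-(∫ ω, X r ω ^ 2 ∂P) / 2) : ℂ) := by
    intro r
    obtain ⟨v, hv⟩ := hG r
    have h1 := charFun_gaussianReal (μ := 0) (v := v) 1
    rw [← hv, charFun_apply_real, integral_map (hX r).aemeasurable (by fun_prop)] at h1
    rw [integral_sq_of_map_eq_gaussianReal (hX r) hv]
    simpa [neg_div] using h1
  have hlog : ∀ r, ∫ ω, X r ω ^ 2 ∂P
      = -2 * Real.log (∫ ω, Complex.exp (X r ω * Complex.I) ∂P).re := by
    intro r
    rw [hchar, Complex.ofReal_re, Real.log_exp]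
    ring
  have hpos : ∀ r, (∫ ω, Complex.exp (X r ω * Complex.I) ∂P).re ≠ 0 := by
    intro r
    rw [hchar, Complex.ofReal_re]
    exact (Real.exp_pos _).ne'
  simp_rw [hlog]
  refine continuous_const.mul (Continuous.log (Complex.continuous_re.comp ?_) hpos)
  refine continuous_iff_continuousAt.2 fun r => ?_
  refine tendsto_of_subseq_tendsto fun u hu => ?_
  obtain ⟨ns, hns⟩ := hsub r u hu
  refine ⟨ns, tendsto_integral_of_dominated_convergence (fun _ => 1) ?_ (integrable_const _) ?_ ?_⟩
  · intro k
    have := hX (u (ns k))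
    exact (by fun_prop : Measurable fun ω => Complex.exp (X (u (ns k)) ω * Complex.I)
      ).aestronglyMeasurable
  · intro k
    simp [Complex.norm_exp_ofReal_mul_I]
  · filter_upwards [hns] with ω hω
    have hc : Continuous fun x : ℝ => Complex.exp (x * Complex.I) := by fun_prop
    exact (hc.tendsto _).comp hω

end GaussianLaw

/-- Cramér–Wold: two processes have the same finite-dimensional distributions if and only if all
finite linear combinations have the same law. -/
lemma hasSameFDD_iff_map_sum {Ω Ω' : Type*} [MeasurableSpace Ω] [MeasurableSpace Ω']
    {P : Measure Ω} {P' : Measure Ω'} [IsProbabilityMeasure P] [IsProbabilityMeasure P']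
    {X : ℝ → Ω → ℝ} {Y : ℝ → Ω' → ℝ} (hX : ∀ t, Measurable (X t)) (hY : ∀ t, Measurable (Y t)) :
    HasSameFDD P P' X Y ↔ ∀ (m : ℕ) (t θ : Fin m → ℝ), (∀ i, 0 ≤ t i) →
      Measure.map (fun ω => ∑ i, θ i * X (t i) ω) P
        = Measure.map (fun ω => ∑ i, θ i * Y (t i) ω) P' := by
  have hmX : ∀ (m : ℕ) (t : Fin m → ℝ), Measurable fun ω i => X (t i) ω :=
    fun m t => measurable_pi_lambda _ fun i => hX _
  have hmY : ∀ (m : ℕ) (t : Fin m → ℝ), Measurable fun ω i => Y (t i) ω :=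
    fun m t => measurable_pi_lambda _ fun i => hY _
  constructor
  · intro h m t θ ht
    have h1 := congrArg (Measure.map fun x : Fin m → ℝ => ∑ i, θ i * x i) (h m t ht)
    rwa [Measure.map_map (by fun_prop) (hmX m t), Measure.map_map (by fun_prop) (hmY m t)] at h1
  · intro h m t ht
    have := Measure.isProbabilityMeasure_map (μ := P) (hmX m t).aemeasurable
    have := Measure.isProbabilityMeasure_map (μ := P') (hmY m t).aemeasurable
    refine Measure.ext_of_charFunDual ?_
    ext L
    have hL : ∀ x : Fin m → ℝ, L x = ∑ i, L (Pi.single i 1) * x i := by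
      intro x
      conv_lhs => rw [← Finset.univ_sum_single x, map_sum]
      refine Finset.sum_congr rfl fun i _ => ?_
      have : (Pi.single i (x i) : Fin m → ℝ) = x i • Pi.single i (1 : ℝ) := by
        rw [← Pi.single_smul]; simp
      rw [this, map_smul, smul_eq_mul, mul_comm]
    rw [charFunDual_eq_charFun_map_one, charFunDual_eq_charFun_map_one,
      Measure.map_map (by fun_prop) (hmX m t), Measure.map_map (by fun_prop) (hmY m t)]
    have h1 := h m t (fun i => L (Pi.single i 1)) ht
    have hLX : (L ∘ fun ω i => X (t i) ω) = fun ω => ∑ i, L (Pi.single i 1) * X (t i) ω :=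
      funext fun ω => hL _
    have hLY : (L ∘ fun ω i => Y (t i) ω) = fun ω => ∑ i, L (Pi.single i 1) * Y (t i) ω :=
      funext fun ω => hL _
    rw [hLX, hLY, h1]

section CenteredGaussianProcess

variable {Ω : Type*} [MeasurableSpace Ω] {P : Measure Ω} {G : ℝ → Ω → ℝ}

lemma IsCenteredGaussianProcess.memLp_two (hGauss : IsCenteredGaussianProcess P G)
    (hGmeas : ∀ t, Measurable (G t)) {t : ℝ} (ht : 0 ≤ t) : MemLp (G t) 2 P := by
  obtain ⟨v, hv⟩ := hGauss 1 (fun _ => t) (fun _ => 1) fun _ => ht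
  refine memLp_two_of_map_eq_gaussianReal (hGmeas t) (v := v) ?_
  simpa using hv

lemma IsCenteredGaussianProcess.integral_sum_sq (hGauss : IsCenteredGaussianProcess P G)
    (hGmeas : ∀ t, Measurable (G t)) {m : ℕ} (t θ : Fin m → ℝ) (ht : ∀ i, 0 ≤ t i) :
    ∫ ω, (∑ i, θ i * G (t i) ω) ^ 2 ∂P
      = ∑ i, ∑ j, θ i * θ j * ∫ ω, G (t i) ω * G (t j) ω ∂P := by
  have hint : ∀ i j, Integrable (fun ω => θ i * θ j * (G (t i) ω * G (t j) ω)) P := fun i j =>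
    ((hGauss.memLp_two hGmeas (ht i)).integrable_mul
      (hGauss.memLp_two hGmeas (ht j))).const_mul _
  simp only [sq, Finset.sum_mul_sum, mul_mul_mul_comm (θ _) (G _ _)]
  rw [integral_finsetSum _ fun i _ => integrable_finsetSum _ fun j _ => hint i j]
  refine Finset.sum_congr rfl fun i _ => ?_
  rw [integral_finsetSum _ fun j _ => hint i j]
  simp_rw [integral_const_mul]

/-- The `α`-IDT property of a centered Gaussian process, in terms of the second moments of linear
combinations. -/
lemma IsCenteredGaussianProcess.isAlphaIDT_iff [IsProbabilityMeasure P]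
    (hGauss : IsCenteredGaussianProcess P G) (hGmeas : ∀ t, Measurable (G t)) (α : ℝ) :
    IsAlphaIDT P α G ↔ ∀ n : ℕ, 0 < n → ∀ (m : ℕ) (t θ : Fin m → ℝ), (∀ i, 0 ≤ t i) →
      ∫ ω, (∑ i, θ i * G ((n : ℝ) ^ (1 / α) * t i) ω) ^ 2 ∂P
        = n * ∫ ω, (∑ i, θ i * G (t i) ω) ^ 2 ∂P := by
  refine forall₂_congr fun n hn => ?_
  have hmeas : ∀ {m : ℕ} (t θ : Fin m → ℝ), Measurable fun ω => ∑ i, θ i * G (t i) ω :=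
    fun t θ => Finset.measurable_sum _ fun i _ => (hGmeas _).const_mul _
  have hmeas' : ∀ t, Measurable fun ω : Fin n → Ω => ∑ j, G t (ω j) :=
    fun t => Finset.measurable_sum _ fun j _ => (hGmeas t).comp (measurable_pi_apply j)
  rw [hasSameFDD_iff_map_sum (fun t => hGmeas _) hmeas']
  refine forall₄_congr fun m t θ ht => ?_
  obtain ⟨v, hv⟩ := hGauss m t θ ht
  obtain ⟨w, hw⟩ := hGauss m (fun i => (n : ℝ) ^ (1 / α) * t i) θ
    fun i => mul_nonneg (by positivity) (ht i)
  have hsum : (fun ω : Fin n → Ω => ∑ i, θ i * ∑ j, G (t i) (ω j))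
      = fun ω => ∑ j, ∑ i, θ i * G (t i) (ω j) := by
    ext ω
    simp_rw [Finset.mul_sum]
    exact Finset.sum_comm
  rw [hsum, map_sum_pi_eq_gaussianReal (hmeas t θ) hv n, hw,
    integral_sq_of_map_eq_gaussianReal (hmeas t θ) hv,
    integral_sq_of_map_eq_gaussianReal (hmeas _ θ) hw]
  constructor
  · intro h
    have h1 := congrArg (fun μ => Var[id; μ]) h
    simpa using h1
  · intro h
    have : w = n * v := by exact_mod_cast h
    rw [this]

/-- Second moments of two-point linear combinations depend continuously on a rescaling of time. -/
lemma IsCenteredGaussianProcess.continuous_integral_sq [IsProbabilityMeasure P]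
    (hGauss : IsCenteredGaussianProcess P G) (hGmeas : ∀ t, Measurable (G t))
    (hcont : StochasticallyContinuous P G) {p q : ℝ → ℝ} (hp : Continuous p) (hq : Continuous q)
    (hp0 : ∀ r, 0 ≤ p r) (hq0 : ∀ r, 0 ≤ q r) (x y : ℝ) :
    Continuous fun r => ∫ ω, (x * G (p r) ω + y * G (q r) ω) ^ 2 ∂P := by
  refine continuous_integral_sq_of_gaussian
    (fun r => ((hGmeas _).const_mul x).add ((hGmeas _).const_mul y)) (fun r => ?_) ?_
  · simpa using hGauss 2 ![p r, q r] ![x, y] (by simp [Fin.forall_fin_two, hp0, hq0])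
  · intro r u hu
    have key : ∀ {f : ℝ → ℝ}, Continuous f → (∀ r, 0 ≤ f r) → ∀ {w : ℕ → ℝ},
        Tendsto w atTop (𝓝 r) → TendstoInMeasure P (fun k => G (f (w k))) atTop (G (f r)) := by
      intro f hf hf0 w hw
      exact (hcont (f r) (hf0 r)).comp (tendsto_nhdsWithin_iff.2
        ⟨(hf.tendsto r).comp hw, Eventually.of_forall fun k => hf0 _⟩)
    obtain ⟨ns, hns, hns'⟩ := (key hp hp0 hu).exists_seq_tendsto_ae
    obtain ⟨ms, hms, hms'⟩ :=
      (key hq hq0 (hu.comp hns.tendsto_atTop)).exists_seq_tendsto_ae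
    refine ⟨ns ∘ ms, ?_⟩
    filter_upwards [hns', hms'] with ω h1 h2
    exact ((h1.comp hms.tendsto_atTop).const_mul x).add (h2.const_mul y)

end CenteredGaussianProcess

/-- A continuous function satisfying `f (n r) = n f r` for positive integers `n` is linear on
positive reals. -/
lemma eq_mul_of_forall_nat_mul {f : ℝ → ℝ} (hf : Continuous f)
    (h : ∀ n : ℕ, 0 < n → ∀ r, 0 ≤ r → f (n * r) = n * f r) {r : ℝ} (hr : 0 ≤ r) :
    f r = r * f 1 := by
  have h0 : f 0 = 0 := by
    have := h 2 two_pos 0 le_rfl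
    simp only [mul_zero, Nat.cast_ofNat] at this
    linarith
  have hnat : ∀ n : ℕ, f n = n * f 1 := by
    intro n
    rcases n.eq_zero_or_pos with rfl | hn
    · simp [h0]
    · simpa using h n hn 1 zero_le_one
  have hrat : ∀ q : ℚ, f |(q : ℝ)| = |(q : ℝ)| * f 1 := by
    intro q
    have hd : (q.den : ℝ) ≠ 0 := by exact_mod_cast q.den_nz
    have hq : (q.den : ℝ) * |(q : ℝ)| = (q.num.natAbs : ℕ) := by
      rw [Nat.cast_natAbs, Rat.cast_def, abs_div, Nat.abs_cast, Int.cast_abs]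
      field_simp
    have h1 := h q.den q.den_pos |(q : ℝ)| (abs_nonneg _)
    rw [hq, hnat, ← hq, mul_assoc] at h1
    exact (mul_left_cancel₀ hd h1).symm
  have hall : (fun x : ℝ => f |x|) = fun x => |x| * f 1 :=
    Rat.denseRange_cast.equalizer (by fun_prop) (by fun_prop) (funext hrat)
  simpa [abs_of_nonneg hr] using congrFun hall r

/-- a centered Gaussian process, continuous in probability, is `α`-IDT if and only
if its covariance function `c(s,t) = E[G_s G_t]` satisfies `c(as, at) = a^α c(s,t)` for all
`a > 0` and `0 ≤ s ≤ t`. -/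
theorem stmt4 {Ω : Type*} [MeasurableSpace Ω] (P : Measure Ω) [IsProbabilityMeasure P]
    (α : ℝ) (hα : 0 < α) (G : ℝ → Ω → ℝ) (hGmeas : ∀ t, Measurable (G t))
    (hGauss : IsCenteredGaussianProcess P G)
    (hcont : StochasticallyContinuous P G) :
    IsAlphaIDT P α G ↔
      ∀ a : ℝ, 0 < a → ∀ s t : ℝ, 0 ≤ s → s ≤ t →
        (∫ ω, G (a * s) ω * G (a * t) ω ∂P) = a ^ α * ∫ ω, G s ω * G t ω ∂P := by
  rw [hGauss.isAlphaIDT_iff hGmeas]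
  constructor
  · intro h a ha s t hs hst
    have ht : 0 ≤ t := hs.trans hst
    have hα' : 0 < 1 / α := by positivity
    have hscale : ∀ x y : ℝ, ∫ ω, (x * G (a * s) ω + y * G (a * t) ω) ^ 2 ∂P
        = a ^ α * ∫ ω, (x * G s ω + y * G t ω) ^ 2 ∂P := by
      intro x y
      have hpow : Continuous fun r : ℝ => |r| ^ (1 / α) :=
        continuous_abs.rpow_const fun _ => Or.inr hα'.le
      have hf := hGauss.continuous_integral_sq hGmeas hcont
        (p := fun r => |r| ^ (1 / α) * s) (q := fun r => |r| ^ (1 / α) * t)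
        (hpow.mul continuous_const) (hpow.mul continuous_const)
        (fun r => by positivity) (fun r => by positivity) x y
      have h1 := eq_mul_of_forall_nat_mul hf (fun n hn r hr => ?_) (Real.rpow_nonneg ha.le α)
      · have h2 : |a ^ α| ^ (1 / α) = a := by
          rw [abs_of_nonneg (by positivity), ← Real.rpow_mul ha.le, mul_one_div_cancel hα.ne',
            Real.rpow_one]
        simpa only [h2, abs_one, Real.one_rpow, one_mul] using h1
      · have h3 := h n hn 2 ![|r| ^ (1 / α) * s, |r| ^ (1 / α) * t] ![x, y]
          (by simp only [Fin.forall_fin_two]; constructor <;> simp <;> positivity)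
        simp only [Fin.sum_univ_two, Matrix.cons_val_zero, Matrix.cons_val_one] at h3
        simp only [abs_mul, Nat.abs_cast]
        rw [Real.mul_rpow (by positivity) (by positivity), mul_assoc, mul_assoc]
        exact h3
    have hpol : ∀ p q : ℝ, 0 ≤ p → 0 ≤ q → ∫ ω, G p ω * G q ω ∂P
        = ((∫ ω, (1 * G p ω + 1 * G q ω) ^ 2 ∂P) - ∫ ω, (1 * G p ω + (-1) * G q ω) ^ 2 ∂P) / 4 := by
      intro p q hp hq
      have hmem : ∀ c : ℝ, MemLp (fun ω => 1 * G p ω + c * G q ω) 2 P := fun c =>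
        ((hGauss.memLp_two hGmeas hp).const_mul 1).add ((hGauss.memLp_two hGmeas hq).const_mul c)
      rw [← integral_sub (hmem 1).integrable_sq (hmem (-1)).integrable_sq, ← integral_div]
      congr with ω
      ring
    rw [hpol _ _ (by positivity) (by positivity), hpol s t hs ht, hscale, hscale]
    ring
  · intro h n hn m t θ ht
    have hn' : (0 : ℝ) < n := by exact_mod_cast hn
    have ha : 0 < (n : ℝ) ^ (1 / α) := by positivity
    have hpow : ((n : ℝ) ^ (1 / α)) ^ α = n := by
      rw [← Real.rpow_mul hn'.le, one_div_mul_cancel hα.ne', Real.rpow_one]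
    have hcov : ∀ i j, ∫ ω, G ((n : ℝ) ^ (1 / α) * t i) ω * G ((n : ℝ) ^ (1 / α) * t j) ω ∂P
        = n * ∫ ω, G (t i) ω * G (t j) ω ∂P := by
      intro i j
      rcases le_total (t i) (t j) with hij | hij
      · rw [h _ ha _ _ (ht i) hij, hpow]
      · have h1 := h _ ha _ _ (ht j) hij
        rw [hpow] at h1
        simp_rw [mul_comm (G ((n : ℝ) ^ (1 / α) * t i) _), mul_comm (G (t i) _)]
        exact h1
    rw [hGauss.integral_sum_sq hGmeas _ θ fun i => mul_nonneg ha.le (ht i),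
      hGauss.integral_sum_sq hGmeas t θ ht]
    simp_rw [hcov, Finset.mul_sum]
    refine Finset.sum_congr rfl fun i _ => Finset.sum_congr rfl fun j _ => ?_
    ring
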